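/- Assume the project is PCL-indexable, i.e., conditions (PCLI1), (PCLI2) and (PCLI3) hold. Then for every finite threshold z ∈ ℝ and every price λ ∈ ℝ, the z-policy is P_λ-optimal if and only if λ = m*(z). -/

import Mathlib

open MeasureTheory ProbabilityTheory Filter Topology Set

noncomputable section

/-- A restless bandit project: the model data (discount factor `β`, passive/active
Markov transition kernels `κ false`/`κ true`, reward `r` and resource consumption `c`),
Assumption 1 (the weighted sup-norm conditions for weight `w` and constants `M`, `γ`),
together with the threshold-policy performance metrics `F`, `G` (for `z`-policies,
active iff `x > z`), `Fm`, `Gm` (for `z⁻`-policies, active iff `x ≥ z`), and the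
optimal value function `V lam` of the `lam`-price problem, each of which is the
(unique) `w`-bounded measurable solution of its fixed-point equation. -/
structure Bandit where
  β : ℝ
  κ : Bool → Kernel ℝ ℝ
  r : ℝ → Bool → ℝ
  c : ℝ → Bool → ℝ
  w : ℝ → ℝ
  M : ℝ
  γ : ℝ
  F : ℝ → EReal → ℝ
  G : ℝ → EReal → ℝ
  Fm : ℝ → EReal → ℝ
  Gm : ℝ → EReal → ℝ
  V : ℝ → ℝ → ℝ
  hβ0 : 0 ≤ β
  hβ1 : β < 1
  hκ : ∀ a, IsMarkovKernel (κ a)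
  hr_cont : ∀ a, Continuous fun x => r x a
  hc_cont : ∀ a, Continuous fun x => c x a
  hc0 : ∀ x, 0 ≤ c x false
  hc01 : ∀ x, c x false < c x true
  hw_meas : Measurable w
  hw_one : ∀ x, 1 ≤ w x
  hM : 0 < M
  hβγ : β ≤ γ
  hγ1 : γ < 1
  hr_bd : ∀ x a, |r x a| ≤ M * w x
  hc_bd : ∀ x a, c x a ≤ M * w x
  hw_int : ∀ a x, Integrable w (κ a x)
  hw_drift : ∀ a x, β * ∫ y, w y ∂(κ a x) ≤ γ * w x
  hF_meas : ∀ z, Measurable fun x => F x z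
  hG_meas : ∀ z, Measurable fun x => G x z
  hFm_meas : ∀ z, Measurable fun x => Fm x z
  hGm_meas : ∀ z, Measurable fun x => Gm x z
  hV_meas : ∀ lam, Measurable (V lam)
  hF_bdd : ∀ z, ∃ C, ∀ x, |F x z| ≤ C * w x
  hG_bdd : ∀ z, ∃ C, ∀ x, |G x z| ≤ C * w x
  hFm_bdd : ∀ z, ∃ C, ∀ x, |Fm x z| ≤ C * w x
  hGm_bdd : ∀ z, ∃ C, ∀ x, |Gm x z| ≤ C * w x
  hV_bdd : ∀ lam, ∃ C, ∀ x, |V lam x| ≤ C * w x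
  hF_eq : ∀ x z, F x z =
    r x (decide (z < (x : EReal))) +
      β * ∫ y, F y z ∂(κ (decide (z < (x : EReal))) x)
  hG_eq : ∀ x z, G x z =
    c x (decide (z < (x : EReal))) +
      β * ∫ y, G y z ∂(κ (decide (z < (x : EReal))) x)
  hFm_eq : ∀ x z, Fm x z =
    r x (decide (z ≤ (x : EReal))) +
      β * ∫ y, Fm y z ∂(κ (decide (z ≤ (x : EReal))) x)
  hGm_eq : ∀ x z, Gm x z =
    c x (decide (z ≤ (x : EReal))) +
      β * ∫ y, Gm y z ∂(κ (decide (z ≤ (x : EReal))) x)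
  hV_eq : ∀ lam x, V lam x =
    max (r x false - lam * c x false + β * ∫ y, V lam y ∂(κ false x))
        (r x true - lam * c x true + β * ∫ y, V lam y ∂(κ true x))

/-- `ν` is the Lebesgue–Stieltjes measure of the (bounded nonincreasing
right-continuous) function `h`: `ν(z₁,z₂] = h z₁ - h z₂`. -/
def IsLSMeasureOfAnti (h : ℝ → ℝ) (ν : Measure ℝ) : Prop :=
  ∀ z₁ z₂ : ℝ, z₁ ≤ z₂ → ν (Set.Ioc z₁ z₂) = ENNReal.ofReal (h z₁ - h z₂)

/-- `ν` is the Lebesgue–Stieltjes measure of the (bounded nondecreasing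
right-continuous) function `h`: `ν(z₁,z₂] = h z₂ - h z₁`. -/
def IsLSMeasureOfMono (h : ℝ → ℝ) (ν : Measure ℝ) : Prop :=
  ∀ z₁ z₂ : ℝ, z₁ ≤ z₂ → ν (Set.Ioc z₁ z₂) = ENNReal.ofReal (h z₂ - h z₁)

/-- The real interval `(z₁, z₂] ⊆ ℝ` with extended-real endpoints. -/
def iocR (z₁ z₂ : EReal) : Set ℝ := {y : ℝ | z₁ < (y : EReal) ∧ (y : EReal) ≤ z₂}

/-- `t`-step distribution of the Markov chain with kernel `κ` and initial law `p`. -/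
def kerIter (κ : Kernel ℝ ℝ) : ℕ → Measure ℝ → Measure ℝ
  | 0, p => p
  | (t + 1), p => (kerIter κ t p).bind fun x => κ x

namespace Bandit

variable (P : Bandit)

/-- Marginal reward metric `f(x,z)` of the `z`-policy. -/
def f (x : ℝ) (z : EReal) : ℝ :=
  (P.r x true - P.r x false) +
    P.β * ((∫ y, P.F y z ∂(P.κ true x)) - ∫ y, P.F y z ∂(P.κ false x))

/-- Marginal resource metric `g(x,z)` of the `z`-policy. -/
def g (x : ℝ) (z : EReal) : ℝ :=
  (P.c x true - P.c x false) +
    P.β * ((∫ y, P.G y z ∂(P.κ true x)) - ∫ y, P.G y z ∂(P.κ false x))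

/-- Marginal reward metric `f(x,z⁻)` of the `z⁻`-policy. -/
def fm (x : ℝ) (z : EReal) : ℝ :=
  (P.r x true - P.r x false) +
    P.β * ((∫ y, P.Fm y z ∂(P.κ true x)) - ∫ y, P.Fm y z ∂(P.κ false x))

/-- Marginal resource metric `g(x,z⁻)` of the `z⁻`-policy. -/
def gm (x : ℝ) (z : EReal) : ℝ :=
  (P.c x true - P.c x false) +
    P.β * ((∫ y, P.Gm y z ∂(P.κ true x)) - ∫ y, P.Gm y z ∂(P.κ false x))

/-- Marginal productivity metric `m(x,z) = f(x,z)/g(x,z)`. -/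
def m (x : ℝ) (z : EReal) : ℝ := P.f x z / P.g x z

/-- Marginal productivity metric `m(x,z⁻) = f(x,z⁻)/g(x,z⁻)`. -/
def mm (x : ℝ) (z : EReal) : ℝ := P.fm x z / P.gm x z

/-- The marginal productivity (MP) index `m*(x) = m(x,x)`. -/
def mStar (x : ℝ) : ℝ := P.m x (x : EReal)

/-- The active action is `P_lam`-optimal at `x`. -/
def ActOpt (lam x : ℝ) : Prop :=
  P.r x false - lam * P.c x false + P.β * ∫ y, P.V lam y ∂(P.κ false x) ≤
    P.r x true - lam * P.c x true + P.β * ∫ y, P.V lam y ∂(P.κ true x)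

/-- The passive action is `P_lam`-optimal at `x`. -/
def PassOpt (lam x : ℝ) : Prop :=
  P.r x true - lam * P.c x true + P.β * ∫ y, P.V lam y ∂(P.κ true x) ≤
    P.r x false - lam * P.c x false + P.β * ∫ y, P.V lam y ∂(P.κ false x)

/-- The project is indexable with index `ν`. -/
def Indexable (ν : ℝ → ℝ) : Prop :=
  ∀ lam x, (P.ActOpt lam x ↔ lam ≤ ν x) ∧ (P.PassOpt lam x ↔ ν x ≤ lam)

/-- The `z`-policy is `P_lam`-optimal. -/
def ZPolicyOpt (z : EReal) (lam : ℝ) : Prop :=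
  ∀ x, P.F x z - lam * P.G x z = P.V lam x

/-- The `z⁻`-policy is `P_lam`-optimal. -/
def ZmPolicyOpt (z : EReal) (lam : ℝ) : Prop :=
  ∀ x, P.Fm x z - lam * P.Gm x z = P.V lam x

/-- The project is strongly threshold-indexable with index `ν`. -/
def StronglyThresholdIndexable (ν : ℝ → ℝ) : Prop :=
  P.Indexable ν ∧
    ∀ lam : ℝ, ∃ z : EReal, P.ZPolicyOpt z lam ∧ P.ZmPolicyOpt z lam

/-- PCL-indexability condition (PCLI1). -/
def PCLI1 : Prop := ∀ (x : ℝ) (z : EReal), 0 < P.g x z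

/-- PCL-indexability condition (PCLI2). -/
def PCLI2 : Prop :=
  Monotone P.mStar ∧ Continuous P.mStar ∧ BddBelow (Set.range P.mStar)

/-- PCL-indexability condition (PCLI3). -/
def PCLI3 : Prop :=
  ∀ x : ℝ, ∀ ν : Measure ℝ, IsLSMeasureOfAnti (fun z : ℝ => P.G x z) ν →
    ∀ z₁ z₂ : ℝ, z₁ < z₂ →
      P.F x z₂ - P.F x z₁ = -∫ z in Set.Ioc z₁ z₂, P.mStar z ∂ν

/-- The project is PCL-indexable. -/
def PCLIndexable : Prop := P.PCLI1 ∧ P.PCLI2 ∧ P.PCLI3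

/-- Reward metric with initial distribution `p`. -/
def Fp (p : Measure ℝ) (z : EReal) : ℝ := ∫ x, P.F x z ∂p

/-- Resource metric with initial distribution `p`. -/
def Gp (p : Measure ℝ) (z : EReal) : ℝ := ∫ x, P.G x z ∂p

/-- `z⁻`-policy reward metric with initial distribution `p`. -/
def Fmp (p : Measure ℝ) (z : EReal) : ℝ := ∫ x, P.Fm x z ∂p

/-- `z⁻`-policy resource metric with initial distribution `p`. -/
def Gmp (p : Measure ℝ) (z : EReal) : ℝ := ∫ x, P.Gm x z ∂p

/-- An admissible initial distribution: a probability measure with `∫ w dp < ∞`. -/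
def IsInitDist (p : Measure ℝ) : Prop :=
  IsProbabilityMeasure p ∧ Integrable P.w p

/-- The transition kernel of the `z`-policy (active iff `x > z`). -/
def thrKer (z : EReal) : Kernel ℝ ℝ :=
  haveI : DecidablePred (· ∈ {x : ℝ | z < (x : EReal)}) := Classical.decPred _
  Kernel.piecewise
    (show MeasurableSet {x : ℝ | z < (x : EReal)} from
      measurable_coe_real_ereal measurableSet_Ioi)
    (P.κ true) (P.κ false)

/-- The transition kernel of the `z⁻`-policy (active iff `x ≥ z`). -/
def thrKerM (z : EReal) : Kernel ℝ ℝ :=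
  haveI : DecidablePred (· ∈ {x : ℝ | z ≤ (x : EReal)}) := Classical.decPred _
  Kernel.piecewise
    (show MeasurableSet {x : ℝ | z ≤ (x : EReal)} from
      measurable_coe_real_ereal measurableSet_Ici)
    (P.κ true) (P.κ false)

/-- The (discounted) state occupation measure `μ_p^z` of the `z`-policy. -/
def occ (z : EReal) (p : Measure ℝ) : Measure ℝ :=
  Measure.sum fun t : ℕ => ENNReal.ofReal (P.β ^ t) • kerIter (P.thrKer z) t p

/-- The (discounted) state occupation measure `μ_p^{z⁻}` of the `z⁻`-policy. -/
def occM (z : EReal) (p : Measure ℝ) : Measure ℝ :=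
  Measure.sum fun t : ℕ => ENNReal.ofReal (P.β ^ t) • kerIter (P.thrKerM z) t p

end Bandit

/-- Finite-horizon reward metric `F_k(x,z)` (value iteration). -/
def Bandit.Fk (P : Bandit) : ℕ → ℝ → EReal → ℝ
  | 0, x, z => P.r x (decide (z < (x : EReal)))
  | (k + 1), x, z =>
      P.r x (decide (z < (x : EReal))) +
        P.β * ∫ y, Bandit.Fk P k y z ∂(P.κ (decide (z < (x : EReal))) x)

/-- Finite-horizon resource metric `G_k(x,z)` (value iteration). -/
def Bandit.Gk (P : Bandit) : ℕ → ℝ → EReal → ℝ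
  | 0, x, z => P.c x (decide (z < (x : EReal)))
  | (k + 1), x, z =>
      P.c x (decide (z < (x : EReal))) +
        P.β * ∫ y, Bandit.Gk P k y z ∂(P.κ (decide (z < (x : EReal))) x)

/-- Finite-horizon marginal reward metric `f_k(x,z)`. -/
def Bandit.fk (P : Bandit) : ℕ → ℝ → EReal → ℝ
  | 0, x, _ => P.r x true - P.r x false
  | (k + 1), x, z =>
      (P.r x true - P.r x false) +
        P.β * ((∫ y, P.Fk k y z ∂(P.κ true x)) - ∫ y, P.Fk k y z ∂(P.κ false x))

/-- Finite-horizon marginal resource metric `g_k(x,z)`. -/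
def Bandit.gk (P : Bandit) : ℕ → ℝ → EReal → ℝ
  | 0, x, _ => P.c x true - P.c x false
  | (k + 1), x, z =>
      (P.c x true - P.c x false) +
        P.β * ((∫ y, P.Gk k y z ∂(P.κ true x)) - ∫ y, P.Gk k y z ∂(P.κ false x))

namespace Bandit

variable (P : Bandit)

/-- Finite-horizon MP metric `m_k(x,z)`. -/
def mk' (k : ℕ) (x : ℝ) (z : EReal) : ℝ := P.fk k x z / P.gk k x z

/-- Finite-horizon MP index `m*_k(x)`. -/
def mkStar (k : ℕ) (x : ℝ) : ℝ := P.mk' k x (x : EReal)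

/-- `g̲(x,z) = inf_k g_k(x,z)`. -/
def gbar (x : ℝ) (z : EReal) : ℝ := ⨅ k : ℕ, P.gk k x z

end Bandit

namespace Bandit

variable (P : Bandit)

/-- A measurable `w`-bounded function is integrable under every transition law. -/
lemma integrable_of_wBounded {D : ℝ → ℝ} {C : ℝ} (hm : Measurable D)
    (hb : ∀ x, |D x| ≤ C * P.w x) (a : Bool) (x : ℝ) : Integrable D (P.κ a x) :=
  ((P.hw_int a x).const_mul C).mono' hm.aestronglyMeasurable (ae_of_all _ hb)

lemma integrable_F (z : EReal) (a : Bool) (x : ℝ) :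
    Integrable (fun y => P.F y z) (P.κ a x) :=
  let ⟨_, hC⟩ := P.hF_bdd z
  P.integrable_of_wBounded (P.hF_meas z) hC a x

lemma integrable_G (z : EReal) (a : Bool) (x : ℝ) :
    Integrable (fun y => P.G y z) (P.κ a x) :=
  let ⟨_, hC⟩ := P.hG_bdd z
  P.integrable_of_wBounded (P.hG_meas z) hC a x

lemma integrable_V (lam : ℝ) (a : Bool) (x : ℝ) :
    Integrable (P.V lam) (P.κ a x) :=
  let ⟨_, hC⟩ := P.hV_bdd lam
  P.integrable_of_wBounded (P.hV_meas lam) hC a x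

/-- Minimum principle: a `w`-bounded function that dominates its discounted one-step mean under
some action at every state is nonnegative. -/
lemma nonneg_of_discounted_mean_le {D : ℝ → ℝ} {C : ℝ} (hm : Measurable D)
    (hb : ∀ x, |D x| ≤ C * P.w x) (hD : ∀ x, ∃ a, P.β * ∫ y, D y ∂(P.κ a x) ≤ D x) (x : ℝ) :
    0 ≤ D x := by
  have hγ0 : 0 ≤ P.γ := P.hβ0.trans P.hβγ
  have hC : 0 ≤ C := by
    have h0 := (abs_nonneg _).trans (hb 0)
    have := P.hw_one 0
    by_contra! hneg
    nlinarith
  have key : ∀ n : ℕ, ∀ x, -(C * P.γ ^ n * P.w x) ≤ D x := by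
    intro n
    induction n with
    | zero => intro x; simpa using (abs_le.1 (hb x)).1
    | succ n ih =>
      intro x
      obtain ⟨a, ha⟩ := hD x
      have h1 : ∫ y, -(C * P.γ ^ n) * P.w y ∂(P.κ a x) ≤ ∫ y, D y ∂(P.κ a x) := by
        refine integral_mono ((P.hw_int a x).const_mul _) (P.integrable_of_wBounded hm hb a x) ?_
        intro y
        have := ih y
        simp only
        linarith
      rw [integral_const_mul] at h1
      have h2 := mul_le_mul_of_nonneg_left h1 P.hβ0
      have h3 := mul_le_mul_of_nonneg_left (P.hw_drift a x) (mul_nonneg hC (pow_nonneg hγ0 n))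
      rw [pow_succ]
      linarith
  have hlim : Tendsto (fun n : ℕ => -(C * P.γ ^ n * P.w x)) atTop (𝓝 (-(C * 0 * P.w x))) :=
    (((tendsto_pow_atTop_nhds_zero_of_lt_one hγ0 P.hγ1).const_mul C).mul_const _).neg
  simpa using le_of_tendsto hlim (Eventually.of_forall fun n => key n x)

lemma exists_wBound_sub {D E : ℝ → ℝ} (hD : ∃ C, ∀ x, |D x| ≤ C * P.w x)
    (hE : ∃ C, ∀ x, |E x| ≤ C * P.w x) : ∃ C, ∀ x, |D x - E x| ≤ C * P.w x := by
  obtain ⟨C, hC⟩ := hD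
  obtain ⟨C', hC'⟩ := hE
  refine ⟨C + C', fun x => (abs_sub _ _).trans ?_⟩
  linarith [hC x, hC' x]

lemma F_eq_active {x z : ℝ} (h : z < x) :
    P.F x z = P.r x true + P.β * ∫ y, P.F y z ∂(P.κ true x) := by
  simpa [h] using P.hF_eq x z

lemma F_eq_passive {x z : ℝ} (h : x ≤ z) :
    P.F x z = P.r x false + P.β * ∫ y, P.F y z ∂(P.κ false x) := by
  simpa [h.not_gt] using P.hF_eq x z

lemma G_eq_active {x z : ℝ} (h : z < x) :
    P.G x z = P.c x true + P.β * ∫ y, P.G y z ∂(P.κ true x) := by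
  simpa [h] using P.hG_eq x z

lemma G_eq_passive {x z : ℝ} (h : x ≤ z) :
    P.G x z = P.c x false + P.β * ∫ y, P.G y z ∂(P.κ false x) := by
  simpa [h.not_gt] using P.hG_eq x z

/-- Decomposition of the change of the resource metric between two thresholds. -/
lemma G_sub_G {z₁ z₂ : ℝ} (h : z₁ ≤ z₂) (x : ℝ) :
    P.G x z₁ - P.G x z₂ = (Ioc z₁ z₂).indicator (fun x => P.g x z₂) x +
      P.β * ∫ y, (P.G y z₁ - P.G y z₂) ∂(P.κ (decide (z₁ < x)) x) := by
  rw [integral_sub (P.integrable_G _ _ _) (P.integrable_G _ _ _)]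
  rcases le_or_gt x z₁ with h1 | h1
  · rw [P.G_eq_passive h1, P.G_eq_passive (h1.trans h), indicator_of_notMem (by simp [h1])]
    simp only [h1.not_gt, decide_false]
    ring
  · rcases le_or_gt x z₂ with h2 | h2
    · rw [P.G_eq_active h1, P.G_eq_passive h2, indicator_of_mem (mem_Ioc.2 ⟨h1, h2⟩)]
      simp only [h1, decide_true, g]
      ring
    · rw [P.G_eq_active h1, P.G_eq_active h2, indicator_of_notMem (by simp [h2])]
      simp only [h1, decide_true]
      ring

lemma PCLI1.antitone_G {P : Bandit} (h : P.PCLI1) (x : ℝ) :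
    Antitone fun z : ℝ => P.G x z := by
  intro z₁ z₂ hz
  obtain ⟨C, hC⟩ := P.exists_wBound_sub (P.hG_bdd z₁) (P.hG_bdd z₂)
  refine sub_nonneg.1 (P.nonneg_of_discounted_mean_le (D := fun x => P.G x z₁ - P.G x z₂)
    ((P.hG_meas z₁).sub (P.hG_meas z₂)) hC (fun x => ⟨decide (z₁ < x), ?_⟩) x)
  have h1 := P.G_sub_G hz x
  have h2 : 0 ≤ (Ioc z₁ z₂).indicator (fun x => P.g x z₂) x :=
    indicator_apply_nonneg fun _ => (h x z₂).le
  linarith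

lemma PCLI1.tendsto_G_add {P : Bandit} (h : P.PCLI1) (z x : ℝ) :
    Tendsto (fun n : ℕ => P.G x ((z + 1 / ((n : ℝ) + 1) : ℝ) : EReal)) atTop
      (𝓝 (P.G x z)) := by
  set u : ℕ → ℝ := fun n => z + 1 / ((n : ℝ) + 1) with hu
  have huz : ∀ n, z < u n := fun n => lt_add_of_pos_right _ Nat.one_div_pos_of_nat
  have hu_anti : Antitone u := fun m n hmn =>
    add_le_add_right (Nat.one_div_le_one_div hmn) z
  have hu_lim : Tendsto u atTop (𝓝 z) := by
    simpa [hu] using tendsto_one_div_add_atTop_nhds_zero_nat.const_add z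
  set D : ℕ → ℝ → ℝ := fun n x => P.G x z - P.G x (u n)
  have hD0 : ∀ n x, 0 ≤ D n x := fun n x => sub_nonneg.2 (h.antitone_G x (huz n).le)
  have hD_anti : ∀ x, Antitone fun n => D n x := fun x m n hmn =>
    sub_le_sub_left (h.antitone_G x (hu_anti hmn)) _
  have hDm : ∀ n, Measurable (D n) := fun n => (P.hG_meas z).sub (P.hG_meas (u n))
  obtain ⟨C, hC⟩ := P.exists_wBound_sub (P.hG_bdd z) (P.hG_bdd (u 0))
  have hDC : ∀ n x, |D n x| ≤ C * P.w x := fun n x => by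
    rw [abs_of_nonneg (hD0 n x)]
    exact (hD_anti x (Nat.zero_le n)).trans ((le_abs_self _).trans (hC x))
  set L : ℝ → ℝ := fun x => ⨅ n, D n x
  have hlim : ∀ x, Tendsto (fun n => D n x) atTop (𝓝 (L x)) := fun x =>
    tendsto_atTop_ciInf (hD_anti x) ⟨0, by rintro _ ⟨n, rfl⟩; exact hD0 n x⟩
  have hLm : Measurable L :=
    measurable_of_tendsto_metrizable hDm (tendsto_pi_nhds.2 hlim)
  have hLC : ∀ x, |L x| ≤ C * P.w x := fun x =>
    le_of_tendsto (hlim x).abs (Eventually.of_forall fun n => hDC n x)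
  have hLeq : ∀ x, L x = P.β * ∫ y, L y ∂(P.κ (decide (z < x)) x) := by
    intro x
    have hint : Tendsto (fun n => ∫ y, D n y ∂(P.κ (decide (z < x)) x)) atTop
        (𝓝 (∫ y, L y ∂(P.κ (decide (z < x)) x))) :=
      tendsto_integral_of_dominated_convergence (fun y => C * P.w y)
        (fun n => (hDm n).aestronglyMeasurable) ((P.hw_int _ x).const_mul C)
        (fun n => ae_of_all _ (hDC n)) (ae_of_all _ hlim)
    refine tendsto_nhds_unique (hlim x) ((hint.const_mul P.β).congr' ?_)
    have hev : ∀ᶠ n in atTop, x ∉ Ioc z (u n) := by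
      rcases le_or_gt x z with hx | hx
      · exact Eventually.of_forall fun n hn => hx.not_gt hn.1
      · filter_upwards [hu_lim.eventually_lt_const hx] with n hn hmem
        exact hn.not_ge hmem.2
    filter_upwards [hev] with n hn
    have := P.G_sub_G (huz n).le x
    rw [indicator_of_notMem hn, zero_add] at this
    exact this.symm
  have hL0 : L x = 0 := by
    refine le_antisymm ?_ (ge_of_tendsto (hlim x) (Eventually.of_forall fun n => hD0 n x))
    have := P.nonneg_of_discounted_mean_le (D := fun x => -L x) (C := C) hLm.neg
      (fun x => by simpa using hLC x)
      (fun x => ⟨decide (z < x), by rw [integral_neg, hLeq x]; linarith⟩) x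
    linarith
  have := (hlim x).const_sub (P.G x z)
  rw [hL0, sub_zero] at this
  exact this.congr fun n => sub_sub_cancel _ _

lemma PCLI1.continuousWithinAt_G {P : Bandit} (h : P.PCLI1) (x z : ℝ) :
    ContinuousWithinAt (fun z : ℝ => P.G x z) (Ici z) z := by
  rw [ContinuousWithinAt, tendsto_order]
  refine ⟨fun a ha => ?_, fun a ha => ?_⟩
  · obtain ⟨n, hn⟩ := ((h.tendsto_G_add z x).eventually_const_lt ha).exists
    have hz : z < z + 1 / ((n : ℝ) + 1) := lt_add_of_pos_right _ Nat.one_div_pos_of_nat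
    filter_upwards [mem_nhdsWithin_of_mem_nhds (Iio_mem_nhds hz)] with y hy
    exact hn.trans_le (h.antitone_G x (le_of_lt hy))
  · filter_upwards [self_mem_nhdsWithin] with y hy
    exact (h.antitone_G x hy).trans_lt ha

lemma PCLI1.exists_isLSMeasureOfAnti {P : Bandit} (h : P.PCLI1) (x : ℝ) :
    ∃ ν : Measure ℝ, IsLSMeasureOfAnti (fun z : ℝ => P.G x z) ν := by
  let S : StieltjesFunction ℝ :=
    { toFun := fun z : ℝ => -P.G x z
      mono' := (h.antitone_G x).neg
      right_continuous' := fun z => (h.continuousWithinAt_G x z).neg }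
  refine ⟨S.measure, fun z₁ z₂ _ => ?_⟩
  rw [S.measure_Ioc]
  congr 1
  change -P.G x z₂ - -P.G x z₁ = _
  ring

/-- The change of the reward metric between two thresholds is comparable to that of the resource
metric, with rates given by the MP index at the two thresholds. -/
lemma PCLIndexable.F_sub_F_mem_Icc {P : Bandit} (h : P.PCLIndexable) (y : ℝ) {z₁ z₂ : ℝ}
    (hz : z₁ ≤ z₂) :
    P.F y z₁ - P.F y z₂ ∈ Icc (P.mStar z₁ * (P.G y z₁ - P.G y z₂))
      (P.mStar z₂ * (P.G y z₁ - P.G y z₂)) := by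
  obtain ⟨h1, ⟨hmono, hcont, -⟩, h3⟩ := h
  rcases hz.eq_or_lt with rfl | hlt
  · simp
  obtain ⟨ν, hν⟩ := h1.exists_isLSMeasureOfAnti y
  have hF := h3 y ν hν z₁ z₂ hlt
  have hνI := hν z₁ z₂ hz
  have hΔ : 0 ≤ P.G y z₁ - P.G y z₂ := sub_nonneg.2 (h1.antitone_G y hz)
  have hfin : ν (Ioc z₁ z₂) ≠ ⊤ := by rw [hνI]; exact ENNReal.ofReal_ne_top
  have hreal : ν.real (Ioc z₁ z₂) = P.G y z₁ - P.G y z₂ := by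
    rw [measureReal_def, hνI, ENNReal.toReal_ofReal hΔ]
  have hint : IntegrableOn P.mStar (Ioc z₁ z₂) ν := by
    refine IntegrableOn.of_bound hfin.lt_top hcont.measurable.aestronglyMeasurable
      (max |P.mStar z₁| |P.mStar z₂|) ?_
    filter_upwards [ae_restrict_mem measurableSet_Ioc] with b hb
    exact abs_le_max_abs_abs (hmono hb.1.le) (hmono hb.2)
  have hlow : ∫ _ in Ioc z₁ z₂, P.mStar z₁ ∂ν ≤ ∫ b in Ioc z₁ z₂, P.mStar b ∂ν :=
    setIntegral_mono_on (integrableOn_const hfin) hint measurableSet_Ioc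
      fun b hb => hmono hb.1.le
  have hupp : ∫ b in Ioc z₁ z₂, P.mStar b ∂ν ≤ ∫ _ in Ioc z₁ z₂, P.mStar z₂ ∂ν :=
    setIntegral_mono_on hint (integrableOn_const hfin) measurableSet_Ioc
      fun b hb => hmono hb.2
  rw [setIntegral_const, hreal, smul_eq_mul, mul_comm] at hlow hupp
  constructor <;> linarith

/-- A function whose increments are dominated by the product of the increments of a continuous
monotone function and of an antitone function is antitone. -/
lemma antitone_of_sub_le_mul_sub {φ m H : ℝ → ℝ} (hm : Continuous m) (hH : Antitone H)
    (h : ∀ a b, a ≤ b → φ b - φ a ≤ (m b - m a) * (H a - H b)) : Antitone φ := by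
  intro a b hab
  have hHab : 0 ≤ H a - H b := sub_nonneg.2 (hH hab)
  have key : ∀ ε > 0, φ b - φ a ≤ ε * (H a - H b) := by
    intro ε hε
    obtain ⟨δ, hδ, hmδ⟩ := Metric.uniformContinuousOn_iff.1
      (isCompact_Icc.uniformContinuousOn_of_continuous (hm.continuousOn (s := Icc a b))) ε hε
    obtain ⟨n, hn⟩ := exists_nat_gt ((b - a) / δ)
    have hn0 : (0 : ℝ) < n := (div_nonneg (sub_nonneg.2 hab) hδ.le).trans_lt hn
    have hstep : (b - a) / n < δ := by
      rw [div_lt_iff₀ hδ] at hn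
      rw [div_lt_iff₀ hn0]
      linarith
    have hstep0 : 0 ≤ (b - a) / n := div_nonneg (sub_nonneg.2 hab) hn0.le
    set t : ℕ → ℝ := fun i => a + i * ((b - a) / n) with ht
    have htsucc : ∀ i, t (i + 1) = t i + (b - a) / n := fun i => by
      simp only [ht]; push_cast; ring
    have htn : t n = b := by simp only [ht]; field_simp; ring
    have htmono : Monotone t := monotone_nat_of_le_succ fun i => by rw [htsucc]; linarith
    have ht0 : t 0 = a := by simp [ht]
    have hind : ∀ i ≤ n, φ (t i) - φ a ≤ ε * (H a - H (t i)) := by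
      intro i
      induction i with
      | zero => intro _; simp [ht0]
      | succ i ih =>
        intro hi
        have hle : t i ≤ t (i + 1) := htmono (Nat.le_succ i)
        have hmem : ∀ j ≤ n, t j ∈ Icc a b := fun j hj =>
          ⟨ht0 ▸ htmono (Nat.zero_le j), htn ▸ htmono hj⟩
        have hdist := hmδ (t (i + 1)) (hmem _ hi) (t i) (hmem _ (by omega)) (by
          rw [Real.dist_eq, htsucc, add_sub_cancel_left, abs_of_nonneg hstep0]
          exact hstep)
        rw [Real.dist_eq] at hdist
        have h1 := mul_le_mul_of_nonneg_right ((le_abs_self _).trans hdist.le)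
          (sub_nonneg.2 (hH hle))
        have h2 := h _ _ hle
        have h3 := ih (by omega)
        linarith
    simpa [htn] using hind n le_rfl
  have hlim : Tendsto (fun ε : ℝ => ε * (H a - H b)) (𝓝[>] 0) (𝓝 (0 * (H a - H b))) :=
    (tendsto_id.mul_const _).mono_left nhdsWithin_le_nhds
  have := ge_of_tendsto hlim (eventually_nhdsWithin_of_forall fun ε hε => key ε hε)
  linarith

lemma PCLIndexable.antitone_f_sub_mStar_mul_g {P : Bandit} (h : P.PCLIndexable) (x : ℝ) :
    Antitone fun z : ℝ => P.f x z - P.mStar z * P.g x z := by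
  refine antitone_of_sub_le_mul_sub
    (H := fun z => P.β * ((∫ y, P.G y z ∂(P.κ true x)) + ∫ y, P.G y z ∂(P.κ false x)))
    h.2.1.2.1 ?_ ?_
  · intro z₁ z₂ hz
    have hle : ∀ a, ∫ y, P.G y z₂ ∂(P.κ a x) ≤ ∫ y, P.G y z₁ ∂(P.κ a x) := fun a =>
      integral_mono (P.integrable_G _ _ _) (P.integrable_G _ _ _)
        fun y => h.1.antitone_G y hz
    exact mul_le_mul_of_nonneg_left (add_le_add (hle _) (hle _)) P.hβ0
  · intro z₁ z₂ hz
    have hΔF : ∀ a, Integrable (fun y => P.F y z₁ - P.F y z₂) (P.κ a x) := fun a =>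
      (P.integrable_F _ _ _).sub (P.integrable_F _ _ _)
    have hΔG : ∀ a, Integrable (fun y => P.G y z₁ - P.G y z₂) (P.κ a x) := fun a =>
      (P.integrable_G _ _ _).sub (P.integrable_G _ _ _)
    have hlow : P.mStar z₁ * ((∫ y, P.G y z₁ ∂(P.κ true x)) - ∫ y, P.G y z₂ ∂(P.κ true x)) ≤
        (∫ y, P.F y z₁ ∂(P.κ true x)) - ∫ y, P.F y z₂ ∂(P.κ true x) := by
      have := integral_mono ((hΔG true).const_mul (P.mStar z₁)) (hΔF true)
        fun y => (h.F_sub_F_mem_Icc y hz).1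
      rwa [integral_const_mul, integral_sub (P.integrable_G _ _ _) (P.integrable_G _ _ _),
        integral_sub (P.integrable_F _ _ _) (P.integrable_F _ _ _)] at this
    have hupp : (∫ y, P.F y z₁ ∂(P.κ false x)) - ∫ y, P.F y z₂ ∂(P.κ false x) ≤
        P.mStar z₂ * ((∫ y, P.G y z₁ ∂(P.κ false x)) - ∫ y, P.G y z₂ ∂(P.κ false x)) := by
      have := integral_mono (hΔF false) ((hΔG false).const_mul (P.mStar z₂))
        fun y => (h.F_sub_F_mem_Icc y hz).2
      rwa [integral_const_mul, integral_sub (P.integrable_G _ _ _) (P.integrable_G _ _ _),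
        integral_sub (P.integrable_F _ _ _) (P.integrable_F _ _ _)] at this
    have hlow' := mul_le_mul_of_nonneg_left hlow P.hβ0
    have hupp' := mul_le_mul_of_nonneg_left hupp P.hβ0
    have hGt : ∫ y, P.G y z₂ ∂(P.κ true x) ≤ ∫ y, P.G y z₁ ∂(P.κ true x) :=
      integral_mono (P.integrable_G _ _ _) (P.integrable_G _ _ _)
        fun y => h.1.antitone_G y hz
    have hg := mul_nonneg (sub_nonneg.2 (h.2.1.1 hz)) (h.1 x z₂).le
    have hG' := mul_nonneg (mul_nonneg (sub_nonneg.2 (h.2.1.1 hz)) P.hβ0) (sub_nonneg.2 hGt)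
    simp only [f, g] at hg ⊢
    linarith

lemma PCLIndexable.f_self {P : Bandit} (h : P.PCLIndexable) (x : ℝ) :
    P.f x x = P.mStar x * P.g x x := by
  rw [mStar, m, div_mul_cancel₀ _ (h.1 x x).ne']

lemma PCLIndexable.f_le {P : Bandit} (h : P.PCLIndexable) {x z : ℝ} (hxz : x ≤ z) :
    P.f x z ≤ P.mStar z * P.g x z := by
  have := h.antitone_f_sub_mStar_mul_g x hxz
  simp only [h.f_self x] at this
  linarith

lemma PCLIndexable.le_f {P : Bandit} (h : P.PCLIndexable) {x z : ℝ} (hzx : z ≤ x) :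
    P.mStar z * P.g x z ≤ P.f x z := by
  have := h.antitone_f_sub_mStar_mul_g x hzx
  simp only [h.f_self x] at this
  linarith

lemma integral_F_sub_mul_G (z : EReal) (lam : ℝ) (a : Bool) (x : ℝ) :
    ∫ y, (P.F y z - lam * P.G y z) ∂(P.κ a x) =
      (∫ y, P.F y z ∂(P.κ a x)) - lam * ∫ y, P.G y z ∂(P.κ a x) := by
  rw [integral_sub (P.integrable_F _ _ _) ((P.integrable_G _ _ _).const_mul lam),
    integral_const_mul]

/-- For an optimal threshold, the advantage of the active action over the passive one is
`f(x,z) - λ g(x,z)`. -/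
lemma ZPolicyOpt.advantage_eq {P : Bandit} {z : EReal} {lam : ℝ} (h : P.ZPolicyOpt z lam)
    (x : ℝ) :
    (P.r x true - lam * P.c x true + P.β * ∫ y, P.V lam y ∂(P.κ true x)) -
      (P.r x false - lam * P.c x false + P.β * ∫ y, P.V lam y ∂(P.κ false x)) =
      P.f x z - lam * P.g x z := by
  have hV : P.V lam = fun y => P.F y z - lam * P.G y z := funext fun y => (h y).symm
  rw [hV, P.integral_F_sub_mul_G, P.integral_F_sub_mul_G, f, g]
  ring

/-- A threshold policy is optimal iff it is optimal against one-step deviations. -/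
lemma zPolicyOpt_iff_oneStep (z lam : ℝ) :
    P.ZPolicyOpt z lam ↔
      ∀ x, (x ≤ z → P.f x z ≤ lam * P.g x z) ∧ (z < x → lam * P.g x z ≤ P.f x z) := by
  constructor
  · intro h x
    have hadv := h.advantage_eq x
    have hV : P.V lam = fun y => P.F y z - lam * P.G y z := funext fun y => (h y).symm
    have hmax := P.hV_eq lam x
    have hl := (le_max_left _ _).trans_eq hmax.symm
    have hr := (le_max_right _ _).trans_eq hmax.symm
    have hint := fun a => P.integral_F_sub_mul_G z lam a x
    rw [← hV] at hint
    have hx := h x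
    constructor
    · intro hxz
      rw [P.F_eq_passive hxz, P.G_eq_passive hxz] at hx
      rw [hint false] at hadv
      linarith
    · intro hxz
      rw [P.F_eq_active hxz, P.G_eq_active hxz] at hx
      rw [hint true] at hadv
      linarith
  · intro h
    set v : ℝ → ℝ := fun y => P.F y z - lam * P.G y z with hv
    have hvm : Measurable v := (P.hF_meas z).sub ((P.hG_meas z).const_mul lam)
    have hvC : ∃ C, ∀ x, |v x| ≤ C * P.w x := by
      obtain ⟨C, hC⟩ := P.hG_bdd z
      refine P.exists_wBound_sub (P.hF_bdd z) ⟨|lam| * C, fun x => ?_⟩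
      rw [abs_mul, mul_assoc]
      exact mul_le_mul_of_nonneg_left (hC x) (abs_nonneg _)
    have hvi : ∀ a x, Integrable v (P.κ a x) := fun a x =>
      let ⟨_, hC⟩ := hvC
      P.integrable_of_wBounded hvm hC a x
    let Q : (ℝ → ℝ) → Bool → ℝ → ℝ := fun u a x =>
      P.r x a - lam * P.c x a + P.β * ∫ y, u y ∂(P.κ a x)
    have hQsub : ∀ a x, Q v a x - Q (P.V lam) a x =
        P.β * ∫ y, (v y - P.V lam y) ∂(P.κ a x) := fun a x => by
      rw [integral_sub (hvi a x) (P.integrable_V lam a x)]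
      simp only [Q]
      ring
    have hVQ : ∀ a x, Q (P.V lam) a x ≤ P.V lam x := fun a x => by
      rw [P.hV_eq lam x]
      cases a
      · exact le_max_left _ _
      · exact le_max_right _ _
    have hVex : ∀ x, ∃ a, P.V lam x = Q (P.V lam) a x := fun x => by
      rcases max_choice (Q (P.V lam) false x) (Q (P.V lam) true x) with hc | hc
      · exact ⟨false, (P.hV_eq lam x).trans hc⟩
      · exact ⟨true, (P.hV_eq lam x).trans hc⟩
    have hadv : ∀ x, Q v true x - Q v false x = P.f x z - lam * P.g x z := fun x => by
      simp only [Q, hv, P.integral_F_sub_mul_G, f, g]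
      ring
    have hvQ : ∀ x, v x = Q v (decide (z < x)) x := fun x => by
      rcases le_or_gt x z with hx | hx
      · simp only [Q, hv, P.integral_F_sub_mul_G, hx.not_gt, decide_false]
        rw [P.F_eq_passive hx, P.G_eq_passive hx]
        ring
      · simp only [Q, hv, P.integral_F_sub_mul_G, hx, decide_true]
        rw [P.F_eq_active hx, P.G_eq_active hx]
        ring
    have hQv : ∀ a x, Q v a x ≤ v x := fun a x => by
      have h1 := hadv x
      have h2 := hvQ x
      rcases le_or_gt x z with hx | hx
      · have h3 := (h x).1 hx
        simp only [hx.not_gt, decide_false] at h2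
        cases a <;> linarith
      · have h3 := (h x).2 hx
        simp only [hx, decide_true] at h2
        cases a <;> linarith
    obtain ⟨C, hC⟩ := P.exists_wBound_sub hvC (P.hV_bdd lam)
    intro x
    refine le_antisymm ?_ ?_
    · refine sub_nonneg.1 (P.nonneg_of_discounted_mean_le ((P.hV_meas lam).sub hvm)
        (fun x => (abs_sub_comm _ _).trans_le (hC x)) (fun x => ⟨decide (z < x), ?_⟩) x)
      have h1 := hQsub (decide (z < x)) x
      have h2 := hVQ (decide (z < x)) x
      have h3 := hvQ x
      have h4 : ∫ y, (P.V lam - v) y ∂(P.κ (decide (z < x)) x) =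
          -∫ y, (v y - P.V lam y) ∂(P.κ (decide (z < x)) x) := by
        rw [← integral_neg]
        exact integral_congr_ae (ae_of_all _ fun y => (neg_sub _ _).symm)
      rw [h4, Pi.sub_apply]
      linarith
    · refine sub_nonneg.1 (P.nonneg_of_discounted_mean_le (hvm.sub (P.hV_meas lam))
        hC (fun x => ?_) x)
      obtain ⟨a, ha⟩ := hVex x
      refine ⟨a, ?_⟩
      have h1 := hQsub a x
      have h2 := hQv a x
      simp only [Pi.sub_apply]
      linarith

lemma PCLIndexable.zPolicyOpt_mStar {P : Bandit} (h : P.PCLIndexable) (z : ℝ) :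
    P.ZPolicyOpt z (P.mStar z) :=
  (P.zPolicyOpt_iff_oneStep z _).2 fun _ => ⟨h.f_le, fun hx => h.le_f hx.le⟩

end Bandit

/-- Under PCL-indexability, for a finite threshold `z` the `z`-policy is
`P_λ`-optimal iff `λ = m*(z)`. -/
theorem zPolicyOpt_iff_eq_mpIndex (P : Bandit) (h : P.PCLIndexable)
    (z : ℝ) (lam : ℝ) :
    P.ZPolicyOpt z lam ↔ lam = P.mStar z := by
  refine ⟨fun hopt => ?_, fun hlam => hlam ▸ h.zPolicyOpt_mStar z⟩
  have hone := (P.zPolicyOpt_iff_oneStep z lam).1 hopt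
  refine le_antisymm ?_ ?_
  · by_contra! hlt
    obtain ⟨x, hx, hzx⟩ : ∃ x, P.mStar x < lam ∧ z < x :=
      (((h.2.1.2.1.tendsto z).eventually_lt_const hlt).filter_mono nhdsWithin_le_nhds |>.and
        (self_mem_nhdsWithin : Ioi z ∈ 𝓝[>] z)).exists
    have hopt' : P.ZPolicyOpt z (P.mStar x) :=
      (P.zPolicyOpt_iff_oneStep z _).2 fun y =>
        ⟨fun hy => (h.f_le hy).trans
            (mul_le_mul_of_nonneg_right (h.2.1.1 hzx.le) (h.1 y z).le),
          fun hy => (mul_le_mul_of_nonneg_right hx.le (h.1 y z).le).trans ((hone y).2 hy)⟩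
    have heq := (hopt'.advantage_eq x).symm.trans ((h.zPolicyOpt_mStar x).advantage_eq x)
    have hstrict := mul_lt_mul_of_pos_right hx (h.1 x z)
    have hge := (hone x).2 hzx
    have hself := h.f_self x
    linarith
  · have hle := (hone z).1 le_rfl
    rw [h.f_self z] at hle
    exact le_of_mul_le_mul_right hle (h.1 z z)
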